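/- arXiv:2403.04090 — 4 statements merged into one kernel-verified Lean document; each statement's English description precedes it below -/
import Mathlib

section
/- Fix k ∈ ℒ and assume I − Q_{1:k−1,1:k−1} is invertible. Define w_{1:k−1,k} = (I − Q_{1:k−1,1:k−1})^{−1} Q_{1:k−1,k}, set u_L^{(k)} = (w_{1k},…,w_{k−1,k}, 1, 0,…,0)ᵀ ∈ ℝ^J, and u^{(k)} ∈ ℝ^K with ℒ-block u_L^{(k)} and ℋ-block u_H^{(k)} = −A_H^{−⊤} A_{LH}ᵀ u_L^{(k)}. Then for every class l ∈ 𝒦, μ_l ( u_l^{(k)} − Σ_{l'∈𝒦} P_{l l'} u_{l'}^{(k)} ) = μ_{s(l)} ( u_{s(l)}^{(k)} − Σ_{l'∈𝒦} P_{s(l) l'} u_{l'}^{(k)} ), where s(l) ∈ {1,…,J} is the station of class l (and, by the indexing convention, also the lowest-priority class at that station). -/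
open Matrix

/-- Embedding of the lowest-priority classes `ℒ = {1,…,J}` into the classes `𝒦 = {1,…,K}`. -/
def emb {K J : ℕ} (hJK : J ≤ K) (j : Fin J) : Fin K := Fin.castLE hJK j

/-- The set `ℋ = {J+1,…,K}` of higher-priority classes, as a subtype of `Fin K`. -/
abbrev Hty (K J : ℕ) := {l : Fin K // J ≤ (l : ℕ)}

/-- The matrix `B` with `B_{k,k⁺} = 1` and all other entries `0`: entry `(i, c)` is `1`
iff `c ∈ ℋ` and `i = c⁻ = prev c`. -/
def Bmat (K J : ℕ) (prev : Fin K → Fin K) : Matrix (Fin K) (Fin K) ℝ :=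
  Matrix.of fun i c => if J ≤ (c : ℕ) ∧ prev c = i then 1 else 0

/-- `A = (I - Pᵀ) diag(μ) (I - B)`. -/
noncomputable def Amat (K J : ℕ) (P : Matrix (Fin K) (Fin K) ℝ) (μ : Fin K → ℝ)
    (prev : Fin K → Fin K) : Matrix (Fin K) (Fin K) ℝ :=
  (1 - Pᵀ) * Matrix.diagonal μ * (1 - Bmat K J prev)

/-- The `(ℋ,ℋ)` block `A_H` of `A`. -/
noncomputable def AHmat (K J : ℕ) (P : Matrix (Fin K) (Fin K) ℝ) (μ : Fin K → ℝ)
    (prev : Fin K → Fin K) : Matrix (Hty K J) (Hty K J) ℝ :=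
  Matrix.of fun i j => Amat K J P μ prev i j

/-- The `(ℒ,ℋ)` block `A_{LH}` of `A`. -/
noncomputable def ALHmat {K J : ℕ} (hJK : J ≤ K) (P : Matrix (Fin K) (Fin K) ℝ)
    (μ : Fin K → ℝ) (prev : Fin K → Fin K) : Matrix (Fin J) (Hty K J) ℝ :=
  Matrix.of fun i j => Amat K J P μ prev (emb hJK i) j

/-- The `(ℋ,ℒ)` block `A_{HL}` of `A`. -/
noncomputable def AHLmat {K J : ℕ} (hJK : J ≤ K) (P : Matrix (Fin K) (Fin K) ℝ)
    (μ : Fin K → ℝ) (prev : Fin K → Fin K) : Matrix (Hty K J) (Fin J) ℝ :=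
  Matrix.of fun i j => Amat K J P μ prev i (emb hJK j)

/-- The `(ℒ,ℒ)` block `A_L` of `A`. -/
noncomputable def ALmat {K J : ℕ} (hJK : J ≤ K) (P : Matrix (Fin K) (Fin K) ℝ)
    (μ : Fin K → ℝ) (prev : Fin K → Fin K) : Matrix (Fin J) (Fin J) ℝ :=
  Matrix.of fun i j => Amat K J P μ prev (emb hJK i) (emb hJK j)

/-- `Q = P_L - P_{LH} A_H^{-⊤} A_{LH}ᵀ`. -/
noncomputable def Qmat {K J : ℕ} (hJK : J ≤ K) (P : Matrix (Fin K) (Fin K) ℝ)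
    (μ : Fin K → ℝ) (prev : Fin K → Fin K) : Matrix (Fin J) (Fin J) ℝ :=
  (Matrix.of fun i j => P (emb hJK i) (emb hJK j)) -
    (Matrix.of fun (i : Fin J) (h : Hty K J) => P (emb hJK i) h) *
      ((AHmat K J P μ prev)⁻¹)ᵀ * (ALHmat hJK P μ prev)ᵀ

/-- The principal submatrix `Q_{1:k-1,1:k-1}` (indices strictly below `k`). -/
noncomputable def Qlow {J : ℕ} (Q : Matrix (Fin J) (Fin J) ℝ) (k : Fin J) :
    Matrix {i : Fin J // i < k} {i : Fin J // i < k} ℝ :=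
  Matrix.of fun i j => Q i j

/-- `w_{1:k-1,k} = (I - Q_{1:k-1,1:k-1})⁻¹ Q_{1:k-1,k}`. -/
noncomputable def wLow {J : ℕ} (Q : Matrix (Fin J) (Fin J) ℝ) (k : Fin J) :
    {i : Fin J // i < k} → ℝ :=
  ((1 - Qlow Q k)⁻¹).mulVec fun j => Q j k

/-- `w_{jk} = Q_{jk} + Q_{j,1:k-1}(I - Q_{1:k-1,1:k-1})⁻¹ Q_{1:k-1,k}` (rows `j = k,…,J`). -/
noncomputable def wHigh {J : ℕ} (Q : Matrix (Fin J) (Fin J) ℝ) (k : Fin J) (j : Fin J) : ℝ :=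
  Q j k + ∑ l : {l : Fin J // l < k}, Q j l * wLow Q k l

/-- `u_L^{(k)} = (w_{1k},…,w_{k-1,k}, 1, 0,…,0)ᵀ ∈ ℝ^J`. -/
noncomputable def uLvec {J : ℕ} (Q : Matrix (Fin J) (Fin J) ℝ) (k : Fin J) : Fin J → ℝ :=
  fun i => if h : i < k then wLow Q k ⟨i, h⟩ else if i = k then 1 else 0

/-- `u_H^{(k)} = -A_H^{-⊤} A_{LH}ᵀ u_L^{(k)}`, for a given `ℒ`-block `uL`. -/
noncomputable def uHvec {K J : ℕ} (hJK : J ≤ K) (P : Matrix (Fin K) (Fin K) ℝ)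
    (μ : Fin K → ℝ) (prev : Fin K → Fin K) (uL : Fin J → ℝ) : Hty K J → ℝ :=
  -(((AHmat K J P μ prev)⁻¹)ᵀ.mulVec ((ALHmat hJK P μ prev)ᵀ.mulVec uL))

/-- The vector `u ∈ ℝ^K` with `ℒ`-block `uL` and `ℋ`-block `-A_H^{-⊤} A_{LH}ᵀ uL`. -/
noncomputable def uvec {K J : ℕ} (hJK : J ≤ K) (P : Matrix (Fin K) (Fin K) ℝ)
    (μ : Fin K → ℝ) (prev : Fin K → Fin K) (uL : Fin J → ℝ) : Fin K → ℝ :=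
  fun l => if h : (l : ℕ) < J then uL ⟨l, h⟩
    else uHvec hJK P μ prev uL ⟨l, Nat.le_of_not_lt h⟩

/-- A sum over all classes splits into the sums over `ℒ` and over `ℋ`. -/
theorem sum_eq_sum_emb_add_sum_Hty {K J : ℕ} (hJK : J ≤ K) (g : Fin K → ℝ) :
    ∑ i, g i = ∑ j : Fin J, g (emb hJK j) + ∑ h : Hty K J, g h := by
  rw [← Fintype.sum_subtype_add_sum_subtype (fun i : Fin K => J ≤ (i : ℕ)) g, add_comm]
  congr 1
  refine Fintype.sum_equiv
    ⟨fun i => ⟨(i.1 : ℕ), Nat.lt_of_not_le i.2⟩,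
      fun j => ⟨emb hJK j, Nat.not_le_of_lt j.2⟩, fun _ => rfl, fun _ => rfl⟩ _ _ fun _ => rfl

theorem uvec_emb {K J : ℕ} (hJK : J ≤ K) (P : Matrix (Fin K) (Fin K) ℝ)
    (μ : Fin K → ℝ) (prev : Fin K → Fin K) (uL : Fin J → ℝ) (j : Fin J) :
    uvec hJK P μ prev uL (emb hJK j) = uL j :=
  dif_pos j.2

theorem uvec_Hty {K J : ℕ} (hJK : J ≤ K) (P : Matrix (Fin K) (Fin K) ℝ)
    (μ : Fin K → ℝ) (prev : Fin K → Fin K) (uL : Fin J → ℝ) (h : Hty K J) :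
    uvec hJK P μ prev uL h = uHvec hJK P μ prev uL h :=
  dif_neg (Nat.not_lt_of_le h.2)

/-- The `ℋ`-block of `Aᵀ u` vanishes. -/
theorem uvec_vecMul_Amat {K J : ℕ} (hJK : J ≤ K) (P : Matrix (Fin K) (Fin K) ℝ)
    (μ : Fin K → ℝ) (prev : Fin K → Fin K) (hAH : IsUnit (AHmat K J P μ prev))
    (uL : Fin J → ℝ) (c : Hty K J) :
    (uvec hJK P μ prev uL ᵥ* Amat K J P μ prev) c = 0 := by
  have hH : (AHmat K J P μ prev)ᵀ *ᵥ uHvec hJK P μ prev uL =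
      -((ALHmat hJK P μ prev)ᵀ *ᵥ uL) := by
    rw [uHvec, mulVec_neg, mulVec_mulVec, ← transpose_mul,
      nonsing_inv_mul _ ((isUnit_iff_isUnit_det _).1 hAH), transpose_one, one_mulVec]
  have hc := congrFun hH c
  simp only [mulVec_transpose, vecMul, dotProduct, Pi.neg_apply, AHmat, ALHmat, of_apply] at hc
  simp only [vecMul, dotProduct]
  rw [sum_eq_sum_emb_add_sum_Hty hJK]
  simp only [uvec_emb, uvec_Hty]
  rw [hc, add_neg_cancel]

theorem vecMul_Amat_apply {K J : ℕ} (P : Matrix (Fin K) (Fin K) ℝ)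
    (μ : Fin K → ℝ) (prev : Fin K → Fin K) (u : Fin K → ℝ) {c : Fin K} (hc : J ≤ (c : ℕ)) :
    (u ᵥ* Amat K J P μ prev) c =
      μ c * (u c - ∑ l, P c l * u l) - μ (prev c) * (u (prev c) - ∑ l, P (prev c) l * u l) := by
  have hv (i : Fin K) : (u ᵥ* ((1 - Pᵀ) * diagonal μ)) i = μ i * (u i - ∑ l, P i l * u l) := by
    rw [← vecMul_vecMul, vecMul_diagonal, vecMul_sub, vecMul_one, vecMul_transpose, mul_comm]
    rfl
  have hB (v : Fin K → ℝ) : (v ᵥ* Bmat K J prev) c = v (prev c) := by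
    simp [vecMul, dotProduct, Bmat, hc]
  rw [Amat, ← vecMul_vecMul, vecMul_sub, vecMul_one, Pi.sub_apply, hB, hv, hv]

theorem stmt7 (K J : ℕ) (hJ : 1 ≤ J) (hJK : J ≤ K)
    (s : Fin K → Fin J) (prev : Fin K → Fin K)
    -- class `j ∈ ℒ` is the lowest-priority class at station `j`
    (hs : ∀ j : Fin J, s (emb hJK j) = j)
    -- `l⁻` is at the same station as `l`
    (hprev_station : ∀ c : Fin K, J ≤ (c : ℕ) → s (prev c) = s c)
    -- each class has at most one class immediately above it (`l ↦ l⁻` is injective on `ℋ`)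
    (hprev_inj : ∀ c c' : Fin K, J ≤ (c : ℕ) → J ≤ (c' : ℕ) → prev c = prev c' → c = c')
    -- the priority chain from any class reaches the lowest-priority class of its station
    (hchain : ∀ c : Fin K, ∃ n : ℕ,
      (fun x : Fin K => if J ≤ (x : ℕ) then prev x else x)^[n] c = emb hJK (s c))
    (P : Matrix (Fin K) (Fin K) ℝ) (hP : IsUnit (1 - P))
    (μ : Fin K → ℝ) (hμ : ∀ l, 0 < μ l)
    (hAH : IsUnit (AHmat K J P μ prev))
    (k : Fin J)
    (hQ : IsUnit (1 - Qlow (Qmat hJK P μ prev) k)) :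
    ∀ l : Fin K,
      μ l * (uvec hJK P μ prev (uLvec (Qmat hJK P μ prev) k) l -
          ∑ l' : Fin K, P l l' * uvec hJK P μ prev (uLvec (Qmat hJK P μ prev) k) l')
        = μ (emb hJK (s l)) *
            (uvec hJK P μ prev (uLvec (Qmat hJK P μ prev) k) (emb hJK (s l)) -
              ∑ l' : Fin K, P (emb hJK (s l)) l' *
                uvec hJK P μ prev (uLvec (Qmat hJK P μ prev) k) l') := by
  set u := uvec hJK P μ prev (uLvec (Qmat hJK P μ prev) k) with hu
  have hstep (c : Fin K) (hc : J ≤ (c : ℕ)) :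
      μ (prev c) * (u (prev c) - ∑ l, P (prev c) l * u l) = μ c * (u c - ∑ l, P c l * u l) := by
    have h := uvec_vecMul_Amat hJK P μ prev hAH (uLvec (Qmat hJK P μ prev) k) ⟨c, hc⟩
    rw [← hu, vecMul_Amat_apply P μ prev u hc] at h
    exact (sub_eq_zero.1 h).symm
  intro l
  obtain ⟨n, hn⟩ := hchain l
  rw [← hn]
  clear hn
  induction n with
  | zero => rfl
  | succ n ih =>
    rw [Function.iterate_succ_apply']
    split_ifs with h
    · rw [hstep _ h, ih]
    · exact ih
end

section
/- The Schur complement reflection matrix coincides with R up to a positive diagonal factor: with R̃ = A_L − A_{LH} A_H^{−1} A_{HL}, one has R̃ = R diag(μ_L) = (I − Qᵀ) diag(μ_L), where μ_L = (μ_1,…,μ_J) and diag(μ_L) is the J×J diagonal matrix with these entries. -/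
open Matrix

/-- The columns of `B` indexed by `ℒ` vanish, so the corresponding columns of `A` are those of
`(I - Pᵀ) diag(μ)`. -/
theorem Amat_apply_emb {K J : ℕ} (hJK : J ≤ K) (P : Matrix (Fin K) (Fin K) ℝ) (μ : Fin K → ℝ)
    (prev : Fin K → Fin K) (i : Fin K) (j : Fin J) :
    Amat K J P μ prev i (emb hJK j) = (1 - Pᵀ) i (emb hJK j) * μ (emb hJK j) := by
  have hB : ∀ c, Bmat K J prev c (emb hJK j) = 0 := fun c => by
    simp [Bmat, emb]
  rw [Amat, mul_sub, mul_one, Matrix.sub_apply, mul_diagonal, mul_apply]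
  simp [hB]

theorem ALmat_eq_mul_diagonal {K J : ℕ} (hJK : J ≤ K) (P : Matrix (Fin K) (Fin K) ℝ)
    (μ : Fin K → ℝ) (prev : Fin K → Fin K) :
    ALmat hJK P μ prev = (1 - (Matrix.of fun i j => P (emb hJK i) (emb hJK j))ᵀ) *
      Matrix.diagonal (fun j : Fin J => μ (emb hJK j)) := by
  ext i j
  rw [ALmat, of_apply, Amat_apply_emb, mul_diagonal]
  simp [one_apply, emb, Fin.ext_iff]

theorem AHLmat_eq_mul_diagonal {K J : ℕ} (hJK : J ≤ K) (P : Matrix (Fin K) (Fin K) ℝ)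
    (μ : Fin K → ℝ) (prev : Fin K → Fin K) :
    AHLmat hJK P μ prev =
      -(Matrix.of fun (i : Fin J) (h : Hty K J) => P (emb hJK i) h)ᵀ *
        Matrix.diagonal (fun j : Fin J => μ (emb hJK j)) := by
  ext i j
  have hne : (i : Fin K) ≠ emb hJK j := fun h => by
    have := congrArg Fin.val h
    have := i.2
    simp only [emb, Fin.val_castLE] at *
    omega
  rw [AHLmat, of_apply, Amat_apply_emb, mul_diagonal]
  simp [one_apply, hne]

theorem stmt9 (K J : ℕ) (hJ : 1 ≤ J) (hJK : J ≤ K)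
    (s : Fin K → Fin J) (prev : Fin K → Fin K)
    (hs : ∀ j : Fin J, s (emb hJK j) = j)
    (hprev_station : ∀ c : Fin K, J ≤ (c : ℕ) → s (prev c) = s c)
    (hprev_inj : ∀ c c' : Fin K, J ≤ (c : ℕ) → J ≤ (c' : ℕ) → prev c = prev c' → c = c')
    (hchain : ∀ c : Fin K, ∃ n : ℕ,
      (fun x : Fin K => if J ≤ (x : ℕ) then prev x else x)^[n] c = emb hJK (s c))
    (P : Matrix (Fin K) (Fin K) ℝ) (hP : IsUnit (1 - P))
    (μ : Fin K → ℝ) (hμ : ∀ l, 0 < μ l)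
    (hAH : IsUnit (AHmat K J P μ prev)) :
    ALmat hJK P μ prev -
        ALHmat hJK P μ prev * (AHmat K J P μ prev)⁻¹ * AHLmat hJK P μ prev
      = (1 - (Qmat hJK P μ prev)ᵀ) *
          Matrix.diagonal (fun j : Fin J => μ (emb hJK j)) := by
  rw [ALmat_eq_mul_diagonal, AHLmat_eq_mul_diagonal, Qmat]
  simp only [transpose_sub, transpose_mul, transpose_transpose, Matrix.sub_mul, Matrix.neg_mul,
    Matrix.mul_neg, Matrix.mul_assoc]
  abel
end

section
/- Let E denote the K×J matrix whose (l,j) entry is μ_j if l = j (for l ≤ J) and 0 otherwise, and define the J×J matrix G = C M (I − Pᵀ)^{−1} Pᵀ E. Then (I − Qᵀ) diag(μ_L) (I + G) = diag(μ_L), where μ_L = (μ_1,…,μ_J). Consequently, if I + G is invertible, then its inverse R̄ = (I + G)^{−1} satisfies R̄ = diag(m_L) R diag(μ_L), where m_L = (m_1,…,m_J); that is, the reflection matrices R, R̃ = A_L − A_{LH}A_H^{−1}A_{HL}, and R̄ are equal up to multiplication by positive diagonal matrices: R̃ = R diag(μ_L) and R̄ = diag(m_L) R̃. -/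
open Matrix

/-- The constituency matrix `C`, with `C_{jk} = 1` iff `s(k) = j`. -/
def Cmat (K J : ℕ) (s : Fin K → Fin J) : Matrix (Fin J) (Fin K) ℝ :=
  Matrix.of fun j l => if s l = j then 1 else 0

/-- The `K×J` matrix `E` whose `(l,j)` entry is `μ_j` if `l = j` (for `l ≤ J`) and `0`
otherwise. -/
def Emat {K J : ℕ} (hJK : J ≤ K) (μ : Fin K → ℝ) : Matrix (Fin K) (Fin J) ℝ :=
  Matrix.of fun l j => if l = emb hJK j then μ l else 0

universe u

theorem emb_injective {K J : ℕ} (hJK : J ≤ K) : Function.Injective (emb hJK) :=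
  Fin.castLE_injective hJK

theorem ne_emb_of_le {K J : ℕ} (hJK : J ≤ K) {c : Fin K} (hc : J ≤ (c : ℕ)) (j : Fin J) :
    c ≠ emb hJK j := by
  rintro rfl
  exact absurd j.2 (not_lt.2 hc)

/-- The 0-1 matrix whose columns are the basis vectors indexed by the image of `f`. -/
def inclusionMatrix {m n : Type*} [DecidableEq m] (f : n → m) : Matrix m n ℝ :=
  Matrix.of fun i j => if i = f j then 1 else 0

theorem mul_inclusionMatrix {m n p : Type*} [Fintype m] [DecidableEq m] (f : n → m)
    (A : Matrix p m ℝ) : A * inclusionMatrix f = Matrix.of fun i j => A i (f j) := by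
  ext i j
  simp [inclusionMatrix, Matrix.mul_apply]

theorem inclusionMatrix_transpose_mul {m n p : Type*} [Fintype m] [DecidableEq m] (f : n → m)
    (A : Matrix m p ℝ) : (inclusionMatrix f)ᵀ * A = Matrix.of fun i j => A (f i) j := by
  ext i j
  simp [inclusionMatrix, Matrix.mul_apply]

theorem inclusionMatrix_completeness {K J : ℕ} (hJK : J ≤ K) :
    inclusionMatrix (emb hJK) * (inclusionMatrix (emb hJK))ᵀ +
      inclusionMatrix (Subtype.val : Hty K J → Fin K) *
        (inclusionMatrix (Subtype.val : Hty K J → Fin K))ᵀ = 1 := by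
  ext i j
  simp only [Matrix.add_apply, Matrix.mul_apply, inclusionMatrix, Matrix.of_apply,
    Matrix.transpose_apply, Matrix.one_apply, mul_ite, mul_one, mul_zero]
  by_cases hj : J ≤ (j : ℕ)
  · have h2 : ∀ x : Hty K J, j = x.1 ↔ x = ⟨j, hj⟩ := fun x =>
      ⟨fun h => Subtype.ext h.symm, fun h => by rw [h]⟩
    simp [ne_emb_of_le hJK hj, h2]
  · have h1 : ∀ x : Fin J, j = emb hJK x ↔ x = ⟨j, by omega⟩ := by
      intro x
      simp only [emb, Fin.ext_iff, Fin.val_castLE]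
      exact eq_comm
    have h2 : ∀ x : Hty K J, j ≠ x.1 := by
      rintro x rfl
      exact hj x.2
    have hi : i = emb hJK ⟨j, by omega⟩ ↔ i = j := Iff.rfl
    simp [h1, h2, hi]

/-- The Schur complement of `A` is a left inverse, up to `Δ`, of the `S`-block of any solution
of `A * Y = S * Δ`. -/
theorem schur_mul_block {k l h : Type u} [Fintype k] [Fintype l] [Fintype h]
    [DecidableEq k] [DecidableEq l] [DecidableEq h]
    {S : Matrix k l ℝ} {U : Matrix k h ℝ} (hSU : S * Sᵀ + U * Uᵀ = 1)
    (hSS : Sᵀ * S = 1) (hUS : Uᵀ * S = 0) {A : Matrix k k ℝ} (hA : IsUnit (Uᵀ * A * U))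
    {Y : Matrix k l ℝ} {Δ : Matrix l l ℝ} (hY : A * Y = S * Δ) :
    (Sᵀ * A * S - Sᵀ * A * U * (Uᵀ * A * U)⁻¹ * (Uᵀ * A * S)) * (Sᵀ * Y) = Δ := by
  have hdet := (Matrix.isUnit_iff_isUnit_det _).1 hA
  have split : ∀ {p : Type u} (V : Matrix p k ℝ),
      V * S * (Sᵀ * Y) + V * U * (Uᵀ * Y) = V * Y := by
    intro p V
    calc _ = V * ((S * Sᵀ + U * Uᵀ) * Y) := by
          simp only [Matrix.add_mul, Matrix.mul_add, Matrix.mul_assoc]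
      _ = V * Y := by rw [hSU, Matrix.one_mul]
  have hH : Uᵀ * A * S * (Sᵀ * Y) = -(Uᵀ * A * U * (Uᵀ * Y)) := by
    rw [eq_neg_iff_add_eq_zero, split, Matrix.mul_assoc, hY, ← Matrix.mul_assoc, hUS,
      Matrix.zero_mul]
  have hL : Sᵀ * A * S * (Sᵀ * Y) + Sᵀ * A * U * (Uᵀ * Y) = Δ := by
    rw [split, Matrix.mul_assoc, hY, ← Matrix.mul_assoc, hSS, Matrix.one_mul]
  rw [Matrix.sub_mul, Matrix.mul_assoc (Sᵀ * A * U * _), hH, Matrix.mul_neg,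
    Matrix.mul_assoc (Sᵀ * A * U), Matrix.nonsing_inv_mul_cancel_left _ _ hdet,
    sub_neg_eq_add, hL]

/-- A factor `N` of `A = L * N` is invertible as soon as its kernel avoids the `S`-block and the
`U`-block of `A` is invertible. -/
theorem isUnit_right_factor {k l h : Type*} [Fintype k] [Fintype l] [Fintype h]
    [DecidableEq k] [DecidableEq h]
    {S : Matrix k l ℝ} {U : Matrix k h ℝ} (hSU : S * Sᵀ + U * Uᵀ = 1)
    {L N : Matrix k k ℝ} {C : Matrix l k ℝ} (hC : C * N = Sᵀ)
    (hA : IsUnit (Uᵀ * (L * N) * U)) : IsUnit N := by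
  rw [← Matrix.mulVec_injective_iff_isUnit]
  refine (injective_iff_map_eq_zero (Matrix.mulVecLin N)).2 fun v hv => ?_
  rw [Matrix.mulVecLin_apply] at hv
  have hS : Sᵀ *ᵥ v = 0 := by
    rw [← hC, ← Matrix.mulVec_mulVec, hv, Matrix.mulVec_zero]
  have hv' : v = U *ᵥ (Uᵀ *ᵥ v) := by
    conv_lhs => rw [← Matrix.one_mulVec v, ← hSU, Matrix.add_mulVec, ← Matrix.mulVec_mulVec, hS,
      Matrix.mulVec_zero, zero_add, ← Matrix.mulVec_mulVec]
  have hU : Uᵀ *ᵥ v = 0 := by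
    apply Matrix.mulVec_injective_iff_isUnit.2 hA
    rw [Matrix.mulVec_zero, ← Matrix.mulVec_mulVec, ← hv', ← Matrix.mulVec_mulVec,
      ← Matrix.mulVec_mulVec, hv, Matrix.mulVec_zero, Matrix.mulVec_zero]
  rw [hv', hU, Matrix.mulVec_zero]

theorem Cmat_mul_one_sub_Bmat {K J : ℕ} (hJK : J ≤ K) {s : Fin K → Fin J}
    {prev : Fin K → Fin K} (hs : ∀ j : Fin J, s (emb hJK j) = j)
    (hprev : ∀ c : Fin K, J ≤ (c : ℕ) → s (prev c) = s c) :
    Cmat K J s * (1 - Bmat K J prev) = (inclusionMatrix (emb hJK))ᵀ := by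
  ext j c
  rw [Matrix.mul_sub, Matrix.mul_one, Matrix.sub_apply, Matrix.mul_apply]
  by_cases hc : J ≤ (c : ℕ)
  · simp [Cmat, Bmat, inclusionMatrix, hc, ne_emb_of_le hJK hc, hprev c hc]
  · obtain ⟨i, rfl⟩ : ∃ i, c = emb hJK i := ⟨⟨c, by omega⟩, rfl⟩
    simp [Cmat, Bmat, inclusionMatrix, hc, hs, (emb_injective hJK).eq_iff]

theorem Amat_mul_inclusionMatrix {K J : ℕ} (hJK : J ≤ K) (P : Matrix (Fin K) (Fin K) ℝ)
    (μ : Fin K → ℝ) (prev : Fin K → Fin K) :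
    Amat K J P μ prev * inclusionMatrix (emb hJK) = (1 - Pᵀ) * Emat hJK μ := by
  have h1 : (1 - Bmat K J prev) * inclusionMatrix (emb hJK) = inclusionMatrix (emb hJK) := by
    rw [Matrix.sub_mul, Matrix.one_mul, sub_eq_self, mul_inclusionMatrix]
    ext i j
    simp [Bmat, emb]
  have h2 : Matrix.diagonal μ * inclusionMatrix (emb hJK) = Emat hJK μ := by
    ext i j
    simp [inclusionMatrix, Emat]
  rw [Amat, Matrix.mul_assoc, h1, Matrix.mul_assoc, h2]

theorem Emat_eq_inclusionMatrix_mul {K J : ℕ} (hJK : J ≤ K) (μ : Fin K → ℝ) :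
    Emat hJK μ = inclusionMatrix (emb hJK) * Matrix.diagonal (fun j => μ (emb hJK j)) := by
  ext i j
  simp only [Emat, inclusionMatrix, Matrix.mul_diagonal, Matrix.of_apply]
  split_ifs with h <;> simp [h]

/-- `R̃ = R diag(μ_L)`. -/
theorem schur_eq_reflection_mul_diagonal {K J : ℕ} (hJK : J ≤ K) (P : Matrix (Fin K) (Fin K) ℝ)
    (μ : Fin K → ℝ) (prev : Fin K → Fin K) :
    ALmat hJK P μ prev -
        ALHmat hJK P μ prev * (AHmat K J P μ prev)⁻¹ * AHLmat hJK P μ prev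
      = (1 - (Qmat hJK P μ prev)ᵀ) * Matrix.diagonal (fun j : Fin J => μ (emb hJK j)) := by
  have hcol : ∀ i j, Amat K J P μ prev i (emb hJK j) =
      ((1 : Matrix (Fin K) (Fin K) ℝ) i (emb hJK j) - P (emb hJK j) i) * μ (emb hJK j) := by
    intro i j
    have h := congrFun (congrFun (Amat_mul_inclusionMatrix hJK P μ prev) i) j
    rw [mul_inclusionMatrix, Emat_eq_inclusionMatrix_mul, ← Matrix.mul_assoc,
      mul_inclusionMatrix] at h
    simpa using h
  have hL : ALmat hJK P μ prev = (1 - (Matrix.of fun i j => P (emb hJK i) (emb hJK j))ᵀ) *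
      Matrix.diagonal (fun j : Fin J => μ (emb hJK j)) := by
    ext i j
    simp [ALmat, hcol, Matrix.one_apply, (emb_injective hJK).eq_iff]
  have hHL : AHLmat hJK P μ prev =
      -(Matrix.of fun (i : Fin J) (h : Hty K J) => P (emb hJK i) h)ᵀ *
        Matrix.diagonal (fun j : Fin J => μ (emb hJK j)) := by
    ext i j
    simp [AHLmat, hcol, ne_emb_of_le hJK i.2]
  rw [hL, hHL, ← Matrix.mul_assoc, ← Matrix.sub_mul]
  congr 1
  simp only [Qmat, Matrix.transpose_sub, Matrix.transpose_mul, Matrix.transpose_transpose,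
    Matrix.mul_neg, Matrix.mul_assoc]
  abel

/-- `R̃ (I + G) = diag(μ_L)`. -/
theorem schur_mul_one_add {K J : ℕ} (hJK : J ≤ K) {s : Fin K → Fin J} {prev : Fin K → Fin K}
    (hs : ∀ j : Fin J, s (emb hJK j) = j)
    (hprev : ∀ c : Fin K, J ≤ (c : ℕ) → s (prev c) = s c)
    {P : Matrix (Fin K) (Fin K) ℝ} (hP : IsUnit (1 - P))
    {μ : Fin K → ℝ} (hμ : ∀ l, μ l ≠ 0) (hAH : IsUnit (AHmat K J P μ prev)) :
    (ALmat hJK P μ prev -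
        ALHmat hJK P μ prev * (AHmat K J P μ prev)⁻¹ * AHLmat hJK P μ prev) *
        (1 + Cmat K J s * Matrix.diagonal (fun l : Fin K => (μ l)⁻¹) * (1 - Pᵀ)⁻¹ * Pᵀ *
          Emat hJK μ)
      = Matrix.diagonal (fun j : Fin J => μ (emb hJK j)) := by
  set S := inclusionMatrix (emb hJK) with hS
  set U := inclusionMatrix (Subtype.val : Hty K J → Fin K)
  set A := Amat K J P μ prev with hA
  set N := 1 - Bmat K J prev with hN
  set Dinv := Matrix.diagonal (fun l : Fin K => (μ l)⁻¹) with hDinv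
  have hSU : S * Sᵀ + U * Uᵀ = 1 := inclusionMatrix_completeness hJK
  have hSS : Sᵀ * S = 1 := by
    rw [inclusionMatrix_transpose_mul]
    ext i j
    simp [hS, inclusionMatrix, Matrix.one_apply, (emb_injective hJK).eq_iff]
  have hUS : Uᵀ * S = 0 := by
    rw [inclusionMatrix_transpose_mul]
    ext i j
    simp [hS, inclusionMatrix, ne_emb_of_le hJK i.2]
  have hAL : ALmat hJK P μ prev = Sᵀ * A * S := by
    rw [inclusionMatrix_transpose_mul, mul_inclusionMatrix]; rfl
  have hALH : ALHmat hJK P μ prev = Sᵀ * A * U := by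
    rw [inclusionMatrix_transpose_mul, mul_inclusionMatrix]; rfl
  have hAHL : AHLmat hJK P μ prev = Uᵀ * A * S := by
    rw [inclusionMatrix_transpose_mul, mul_inclusionMatrix]; rfl
  have hAHH : AHmat K J P μ prev = Uᵀ * A * U := by
    rw [inclusionMatrix_transpose_mul, mul_inclusionMatrix]; rfl
  rw [hAHH] at hAH
  have hCN : Cmat K J s * N = Sᵀ := Cmat_mul_one_sub_Bmat hJK hs hprev
  have hNdet := (Matrix.isUnit_iff_isUnit_det _).1 (isUnit_right_factor hSU hCN hAH)
  have hPdet : IsUnit (1 - Pᵀ).det := by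
    rw [← Matrix.transpose_one, ← Matrix.transpose_sub, Matrix.det_transpose]
    exact (Matrix.isUnit_iff_isUnit_det _).1 hP
  have hDD : Matrix.diagonal μ * Dinv = 1 := by
    simp [hDinv, hμ]
  have hDD' : Dinv * Matrix.diagonal μ = 1 := by
    simp [hDinv, hμ]
  have hE : Emat hJK μ = Matrix.diagonal μ * S := by
    ext i j
    simp [hS, inclusionMatrix, Emat]
  have hCS : Cmat K J s * S = 1 := by
    rw [mul_inclusionMatrix]
    ext i j
    simp [Cmat, hs, Matrix.one_apply, eq_comm]
  have hPinv : (1 - Pᵀ)⁻¹ * Pᵀ = (1 - Pᵀ)⁻¹ - 1 := by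
    calc (1 - Pᵀ)⁻¹ * Pᵀ = (1 - Pᵀ)⁻¹ * (1 - (1 - Pᵀ)) := by rw [sub_sub_cancel]
      _ = (1 - Pᵀ)⁻¹ - 1 := by
        rw [Matrix.mul_sub, Matrix.nonsing_inv_mul _ hPdet, Matrix.mul_one]
  have hG : 1 + Cmat K J s * Dinv * (1 - Pᵀ)⁻¹ * Pᵀ * Emat hJK μ =
      Sᵀ * (N⁻¹ * (Dinv * ((1 - Pᵀ)⁻¹ * Emat hJK μ))) := by
    have h1 : Cmat K J s * Dinv * Emat hJK μ = 1 := by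
      rw [hE, Matrix.mul_assoc, ← Matrix.mul_assoc Dinv, hDD', Matrix.one_mul, hCS]
    rw [← hCN, Matrix.mul_assoc (Cmat K J s) N, Matrix.mul_nonsing_inv_cancel_left _ _ hNdet,
      Matrix.mul_assoc (Cmat K J s * Dinv) _ Pᵀ, hPinv, Matrix.mul_sub, Matrix.sub_mul,
      Matrix.mul_one, h1, add_sub_cancel]
    simp only [Matrix.mul_assoc]
  have hY : A * (N⁻¹ * (Dinv * ((1 - Pᵀ)⁻¹ * Emat hJK μ))) =
      S * Matrix.diagonal (fun j : Fin J => μ (emb hJK j)) := by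
    rw [hA, Amat, Matrix.mul_assoc _ N, Matrix.mul_nonsing_inv_cancel_left _ _ hNdet,
      Matrix.mul_assoc, ← Matrix.mul_assoc _ Dinv, hDD, Matrix.one_mul,
      Matrix.mul_nonsing_inv_cancel_left _ _ hPdet, Emat_eq_inclusionMatrix_mul]
  rw [hAL, hALH, hAHL, hAHH, hG]
  exact schur_mul_block hSU hSS hUS hAH hY

theorem stmt11 (K J : ℕ) (hJ : 1 ≤ J) (hJK : J ≤ K)
    (s : Fin K → Fin J) (prev : Fin K → Fin K)
    (hs : ∀ j : Fin J, s (emb hJK j) = j)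
    (hprev_station : ∀ c : Fin K, J ≤ (c : ℕ) → s (prev c) = s c)
    (hprev_inj : ∀ c c' : Fin K, J ≤ (c : ℕ) → J ≤ (c' : ℕ) → prev c = prev c' → c = c')
    (hchain : ∀ c : Fin K, ∃ n : ℕ,
      (fun x : Fin K => if J ≤ (x : ℕ) then prev x else x)^[n] c = emb hJK (s c))
    (P : Matrix (Fin K) (Fin K) ℝ) (hP : IsUnit (1 - P))
    (μ : Fin K → ℝ) (hμ : ∀ l, 0 < μ l)
    (hAH : IsUnit (AHmat K J P μ prev)) :
    -- `(I - Qᵀ) diag(μ_L) (I + G) = diag(μ_L)`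
    (1 - (Qmat hJK P μ prev)ᵀ) * Matrix.diagonal (fun j : Fin J => μ (emb hJK j)) *
        (1 + Cmat K J s * Matrix.diagonal (fun l : Fin K => (μ l)⁻¹) * (1 - Pᵀ)⁻¹ * Pᵀ *
          Emat hJK μ)
      = Matrix.diagonal (fun j : Fin J => μ (emb hJK j)) ∧
    -- `R̃ = R diag(μ_L)`
    (ALmat hJK P μ prev -
        ALHmat hJK P μ prev * (AHmat K J P μ prev)⁻¹ * AHLmat hJK P μ prev
      = (1 - (Qmat hJK P μ prev)ᵀ) * Matrix.diagonal (fun j : Fin J => μ (emb hJK j))) ∧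
    -- consequently, if `I + G` is invertible then `R̄ = (I+G)⁻¹ = diag(m_L) R diag(μ_L) = diag(m_L) R̃`
    (IsUnit (1 + Cmat K J s * Matrix.diagonal (fun l : Fin K => (μ l)⁻¹) * (1 - Pᵀ)⁻¹ * Pᵀ *
        Emat hJK μ) →
      (1 + Cmat K J s * Matrix.diagonal (fun l : Fin K => (μ l)⁻¹) * (1 - Pᵀ)⁻¹ * Pᵀ *
          Emat hJK μ)⁻¹
        = Matrix.diagonal (fun j : Fin J => (μ (emb hJK j))⁻¹) *
            (1 - (Qmat hJK P μ prev)ᵀ) *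
            Matrix.diagonal (fun j : Fin J => μ (emb hJK j)) ∧
      (1 + Cmat K J s * Matrix.diagonal (fun l : Fin K => (μ l)⁻¹) * (1 - Pᵀ)⁻¹ * Pᵀ *
          Emat hJK μ)⁻¹
        = Matrix.diagonal (fun j : Fin J => (μ (emb hJK j))⁻¹) *
            (ALmat hJK P μ prev -
              ALHmat hJK P μ prev * (AHmat K J P μ prev)⁻¹ * AHLmat hJK P μ prev)) := by
  have hschur := schur_eq_reflection_mul_diagonal hJK P μ prev
  have hmul := schur_mul_one_add hJK hs hprev_station hP (fun l => (hμ l).ne') hAH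
  refine ⟨by rw [← hschur]; exact hmul, hschur, fun _ => ?_⟩
  have hinv : Matrix.diagonal (fun j : Fin J => (μ (emb hJK j))⁻¹) *
      Matrix.diagonal (fun j : Fin J => μ (emb hJK j)) = 1 := by
    simp [(hμ _).ne']
  refine ⟨Matrix.inv_eq_left_inv ?_, Matrix.inv_eq_left_inv ?_⟩
  · rw [Matrix.mul_assoc (Matrix.diagonal _), ← hschur, Matrix.mul_assoc, hmul, hinv]
  · rw [Matrix.mul_assoc, hmul, hinv]
end

section
/- For every K-dimensional real vector v and every l ∈ ℋ, the vector v satisfies v_l = v_{l−} for all l ∈ ℋ if and only if v_l = v_{s(l)} for all l ∈ 𝒦; moreover, for u ∈ ℝ^K with v = diag(μ)(I − P)u, the ℋ-block of uᵀA vanishes if and only if v_l = v_{l−} for all l ∈ ℋ, where A = (I − Pᵀ) diag(μ) (I − B). -/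
open Matrix

theorem vecMul_one_sub_Bmat {K J : ℕ} (prev : Fin K → Fin K) (v : Fin K → ℝ) {c : Fin K}
    (hc : J ≤ (c : ℕ)) : vecMul v (1 - Bmat K J prev) c = v c - v (prev c) := by
  rw [vecMul_sub, vecMul_one, Pi.sub_apply]
  simp [vecMul, dotProduct, Bmat, hc]

theorem vecMul_Amat {K J : ℕ} (P : Matrix (Fin K) (Fin K) ℝ) (μ : Fin K → ℝ)
    (prev : Fin K → Fin K) (u : Fin K → ℝ) :
    vecMul u (Amat K J P μ prev) =
      vecMul ((diagonal μ * (1 - P)).mulVec u) (1 - Bmat K J prev) := by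
  rw [Amat, ← vecMul_vecMul, ← vecMul_transpose (diagonal μ * (1 - P)) u, transpose_mul,
    transpose_sub, transpose_one, diagonal_transpose]

theorem stmt15 (K J : ℕ) (hJ : 1 ≤ J) (hJK : J ≤ K)
    (s : Fin K → Fin J) (prev : Fin K → Fin K)
    (hs : ∀ j : Fin J, s (emb hJK j) = j)
    (hprev_station : ∀ c : Fin K, J ≤ (c : ℕ) → s (prev c) = s c)
    (hprev_inj : ∀ c c' : Fin K, J ≤ (c : ℕ) → J ≤ (c' : ℕ) → prev c = prev c' → c = c')
    (hchain : ∀ c : Fin K, ∃ n : ℕ,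
      (fun x : Fin K => if J ≤ (x : ℕ) then prev x else x)^[n] c = emb hJK (s c))
    (P : Matrix (Fin K) (Fin K) ℝ)
    (μ : Fin K → ℝ) (hμ : ∀ l, 0 < μ l)
    (v : Fin K → ℝ) :
    -- `v_l = v_{l⁻}` for all `l ∈ ℋ` iff `v_l = v_{s(l)}` for all `l ∈ 𝒦`
    ((∀ c : Fin K, J ≤ (c : ℕ) → v c = v (prev c)) ↔
      (∀ l : Fin K, v l = v (emb hJK (s l)))) ∧
    -- moreover, if `v = diag(μ)(I - P) u` then the `ℋ`-block of `uᵀA` vanishes iff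
    -- `v_l = v_{l⁻}` for all `l ∈ ℋ`
    (∀ u : Fin K → ℝ, v = (Matrix.diagonal μ * (1 - P)).mulVec u →
      ((∀ c : Fin K, J ≤ (c : ℕ) → Matrix.vecMul u (Amat K J P μ prev) c = 0) ↔
        (∀ c : Fin K, J ≤ (c : ℕ) → v c = v (prev c)))) := by
  refine ⟨⟨fun h l => ?_, fun h c hc => ?_⟩, ?_⟩
  · obtain ⟨n, hn⟩ := hchain l
    have hstep : v ∘ (fun x : Fin K => if J ≤ (x : ℕ) then prev x else x) = v := by
      funext x
      by_cases hx : J ≤ (x : ℕ)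
      · simp [hx, ← h x hx]
      · simp [hx]
    rw [← hn]
    exact (congrFun (Function.iterate_invariant hstep n) l).symm
  · rw [h c, h (prev c), hprev_station c hc]
  · rintro u rfl
    refine forall₂_congr fun c hc => ?_
    rw [vecMul_Amat, vecMul_one_sub_Bmat prev _ hc, sub_eq_zero]
end
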